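/- Let m be a natural number, let a', b ∈ ℂ with (a')_m ≠ 0 and (b)_m ≠ 0, let p, q be real numbers with p > 0, q > 0, p − 1 + m > 0 and q − 1 + m > 0, and let z ∈ ℂ with |z| < 1. Then (1/((p − 1 + m)(q − 1 + m))) · Σ_{i=m}^{∞} [ ((a')_i · (b)_i · (p)_m · (q)_m) / ((a')_m · (b)_m · (p)_i · (q)_i) ] · z^i = ∫_0^1 ∫_0^1 t^{p−2} · u^{q−2} · (z·t·u)^m · ( Σ_{j=0}^{∞} [ ((m + a')_j · (m + b)_j) / ((1)_j · j!) ] · ( z·(1−t)·(1−u) )^j ) dt du, where the inner series converges absolutely for every t, u ∈ [0,1] (since |z(1−t)(1−u)| ≤ |z| < 1) and the double integral over [0,1]² is a Lebesgue integral of an integrable function. -/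

import Mathlib

/-- The rising factorial (Pochhammer symbol) `(x)ₙ = x (x+1) ⋯ (x+n-1)` in `ℂ`. -/
noncomputable def poch (x : ℂ) (n : ℕ) : ℂ := Polynomial.eval x (ascPochhammer ℂ n)

theorem poch_zero (x : ℂ) : poch x 0 = 1 := by simp [poch]

theorem poch_succ (x : ℂ) (n : ℕ) : poch x (n + 1) = poch x n * (x + n) :=
  ascPochhammer_succ_eval n x

theorem poch_one_left (n : ℕ) : poch 1 n = (n.factorial : ℂ) :=
  ascPochhammer_eval_one ℂ n

theorem poch_add (x : ℂ) (m n : ℕ) : poch x (m + n) = poch x m * poch (x + m) n := by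
  simp [poch, ← ascPochhammer_mul]

theorem poch_eq_prod_range (x : ℂ) (n : ℕ) : poch x n = ∏ j ∈ Finset.range n, (x + j) := by
  induction n with
  | zero => simp [poch_zero]
  | succ n ih => rw [poch_succ, Finset.prod_range_succ, ih]

theorem poch_ofReal_ne_zero {x : ℝ} (hx : 0 < x) (n : ℕ) : poch (x : ℂ) n ≠ 0 := by
  rw [poch_eq_prod_range, Finset.prod_ne_zero_iff]
  intro j _
  exact_mod_cast (by positivity : x + j ≠ 0)

open Filter Topology in
theorem tendsto_norm_add_natCast_div_natCast_add_one (a : ℂ) :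
    Tendsto (fun n : ℕ => ‖(a + n) / ((n : ℂ) + 1)‖) atTop (𝓝 1) := by
  have h : Tendsto (fun n : ℕ => (a - 1) * (1 / ((n : ℂ) + 1)) + 1) atTop
      (𝓝 ((a - 1) * 0 + 1)) :=
    (tendsto_one_div_add_atTop_nhds_zero_nat.const_mul _).add_const _
  have h' := h.norm
  simp only [mul_zero, zero_add, norm_one] at h'
  refine h'.congr fun n => ?_
  congr 1
  have : (n : ℂ) + 1 ≠ 0 := Nat.cast_add_one_ne_zero n
  field_simp
  ring

open Filter Topology in
/-- Absolute convergence of the Gauss hypergeometric series `₂F₁(a, b; 1; z)` in the unit disc. -/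
theorem summable_poch_mul_poch_div_mul_pow (a b : ℂ) {z : ℂ} (hz : ‖z‖ < 1) :
    Summable fun j : ℕ => poch a j * poch b j / (poch 1 j * (j.factorial : ℂ)) * z ^ j := by
  obtain ⟨r, hzr, hr⟩ := exists_between hz
  refine summable_of_ratio_norm_eventually_le hr ?_
  have h := ((tendsto_norm_add_natCast_div_natCast_add_one a).mul
    (tendsto_norm_add_natCast_div_natCast_add_one b)).mul_const ‖z‖
  rw [one_mul, one_mul] at h
  filter_upwards [h.eventually_le_const hzr] with n hn
  rw [← norm_mul, ← norm_mul] at hn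
  refine le_trans (le_of_eq ?_) (mul_le_mul_of_nonneg_right hn (norm_nonneg _))
  rw [← norm_mul]
  congr 1
  have h1 : (n : ℂ) + 1 ≠ 0 := Nat.cast_add_one_ne_zero n
  have h2 : (n.factorial : ℂ) ≠ 0 := Nat.cast_ne_zero.mpr n.factorial_ne_zero
  rw [poch_one_left, poch_one_left, poch_succ, poch_succ, Nat.factorial_succ, pow_succ]
  push_cast
  field_simp

theorem intervalIntegrable_rpow_mul_one_sub_pow {r : ℝ} (hr : 0 < r) (j : ℕ) :
    IntervalIntegrable (fun t : ℝ => ((t ^ (r - 1) : ℝ) : ℂ) * (1 - (t : ℂ)) ^ j)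
      MeasureTheory.volume 0 1 := by
  have h' : IntervalIntegrable (fun t : ℝ => t ^ (r - 1)) MeasureTheory.volume 0 1 :=
    intervalIntegral.intervalIntegrable_rpow' (by linarith)
  have h : IntervalIntegrable (fun t : ℝ => ((t ^ (r - 1) : ℝ) : ℂ)) MeasureTheory.volume 0 1 :=
    ⟨h'.1.ofReal, h'.2.ofReal⟩
  exact h.mul_continuousOn (by fun_prop)

/-- The Beta integral `B(r, j + 1)`. -/
theorem integral_rpow_mul_one_sub_pow {r : ℝ} (hr : 0 < r) (j : ℕ) :
    ∫ t in (0:ℝ)..1, ((t ^ (r - 1) : ℝ) : ℂ) * (1 - (t : ℂ)) ^ j =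
      (j.factorial : ℂ) / (r * poch (r + 1) j) := by
  have h := Complex.betaIntegral_eval_nat_add_one_right (u := (r : ℂ)) (by simpa using hr) j
  rw [← poch_eq_prod_range, add_comm j 1, poch_add] at h
  rw [show poch (r : ℂ) 1 = r by simp [poch]] at h
  rw [Nat.cast_one] at h
  rw [← h, Complex.betaIntegral]
  refine intervalIntegral.integral_congr fun t ht => ?_
  rw [Set.uIcc_of_le zero_le_one] at ht
  simp only [add_sub_cancel_right, Complex.cpow_natCast]
  rw [Complex.ofReal_cpow ht.1]
  push_cast
  rfl

open MeasureTheory in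
/-- Termwise integration of a power series in `1 - t` against the weight `t ^ (r - 1)`. -/
theorem hasSum_integral_rpow_mul_tsum {r : ℝ} (hr : 0 < r) {c : ℕ → ℂ} (hc : Summable c) :
    HasSum (fun j : ℕ => c j * ((j.factorial : ℂ) / (r * poch (r + 1) j)))
      (∫ t in (0:ℝ)..1, ((t ^ (r - 1) : ℝ) : ℂ) * ∑' j : ℕ, c j * (1 - (t : ℂ)) ^ j) := by
  have hint (j : ℕ) := intervalIntegrable_rpow_mul_one_sub_pow hr j
  simp only [intervalIntegrable_iff_integrableOn_Ioc_of_le zero_le_one] at hint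
  have hsum := hasSum_integral_of_summable_integral_norm
    (F := fun j (t : ℝ) => c j * (((t ^ (r - 1) : ℝ) : ℂ) * (1 - (t : ℂ)) ^ j))
    (μ := volume.restrict (Set.Ioc 0 1)) (fun j => (hint j).const_mul (c j)) ?_
  · simp only [← intervalIntegral.integral_of_le zero_le_one, intervalIntegral.integral_const_mul,
      integral_rpow_mul_one_sub_pow hr] at hsum
    simpa only [← tsum_mul_left, mul_left_comm] using hsum
  · have hw : IntegrableOn (fun t : ℝ => t ^ (r - 1)) (Set.Ioc 0 1) := by
      rw [← intervalIntegrable_iff_integrableOn_Ioc_of_le zero_le_one]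
      exact intervalIntegral.intervalIntegrable_rpow' (by linarith)
    refine Summable.of_nonneg_of_le (fun j => integral_nonneg fun t => norm_nonneg _) (fun j => ?_)
      (hc.norm.mul_right (∫ t in Set.Ioc (0:ℝ) 1, t ^ (r - 1)))
    rw [← integral_const_mul]
    refine setIntegral_mono_on ((hint j).const_mul (c j)).norm (hw.const_mul _) measurableSet_Ioc
      fun t ht => ?_
    have h1 : ‖(1 - (t : ℂ)) ^ j‖ ≤ 1 := by
      rw [norm_pow]
      refine pow_le_one₀ (norm_nonneg _) ?_
      rw [← Complex.ofReal_one, ← Complex.ofReal_sub, Complex.norm_real, Real.norm_eq_abs, abs_le]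
      constructor <;> linarith [ht.1, ht.2]
    have h0 : 0 ≤ t ^ (r - 1) := Real.rpow_nonneg ht.1.le _
    rw [norm_mul, norm_mul, Complex.norm_real, Real.norm_of_nonneg h0]
    exact mul_le_mul_of_nonneg_left (mul_le_of_le_one_right h0 h1) (norm_nonneg _)

theorem ofReal_rpow_mul_pow {t : ℝ} (ht : 0 < t) (p : ℝ) (m : ℕ) :
    ((t ^ (p - 2) : ℝ) : ℂ) * (t : ℂ) ^ m = ((t ^ (p - 1 + m - 1) : ℝ) : ℂ) := by
  rw [← Complex.ofReal_pow, ← Complex.ofReal_mul, ← Real.rpow_add_natCast ht.ne']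
  ring_nf

/-- identity `V_l`, eq. (313): the tail of the generalized hypergeometric
series occurring in the infinite-series Heun expansion as a double Euler integral
over `[0,1]²`. -/
theorem heun_hypergeometric_tail_eq_double_euler_integral
    (m : ℕ) (a' b : ℂ) (ha' : poch a' m ≠ 0) (hb : poch b m ≠ 0)
    (p q : ℝ) (hp : 0 < p) (hq : 0 < q)
    (hpm : 0 < p - 1 + m) (hqm : 0 < q - 1 + m)
    (z : ℂ) (hz : ‖z‖ < 1) :
    (1 / (((p - 1 + m : ℝ) : ℂ) * ((q - 1 + m : ℝ) : ℂ))) *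
        ∑' i : ℕ,
          (poch a' (m + i) * poch b (m + i) * poch (p : ℂ) m * poch (q : ℂ) m) /
              (poch a' m * poch b m * poch (p : ℂ) (m + i) * poch (q : ℂ) (m + i)) *
            z ^ (m + i) =
      ∫ t in (0:ℝ)..1, ∫ u in (0:ℝ)..1,
        ((t ^ (p - 2) : ℝ) : ℂ) * ((u ^ (q - 2) : ℝ) : ℂ) * (z * (t : ℂ) * (u : ℂ)) ^ m *
          ∑' j : ℕ,
            ((poch ((m : ℂ) + a') j * poch ((m : ℂ) + b) j) /
              (poch 1 j * (Nat.factorial j : ℂ))) *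
              (z * (1 - (t : ℂ)) * (1 - (u : ℂ))) ^ j := by
  set r : ℝ := p - 1 + m with hr
  set s : ℝ := q - 1 + m with hs
  set d : ℕ → ℂ := fun j => poch ((m : ℂ) + a') j * poch ((m : ℂ) + b) j /
    (poch 1 j * (j.factorial : ℂ)) * z ^ j with hd
  have hdsum : Summable d := summable_poch_mul_poch_div_mul_pow _ _ hz
  set β : ℕ → ℂ := fun j => (j.factorial : ℂ) / (s * poch (s + 1) j) with hβ
  have hinner (t : ℝ) (ht : t ∈ Set.Ioc (0:ℝ) 1) :
      (∫ u in (0:ℝ)..1,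
        ((t ^ (p - 2) : ℝ) : ℂ) * ((u ^ (q - 2) : ℝ) : ℂ) * (z * (t : ℂ) * (u : ℂ)) ^ m *
          ∑' j : ℕ,
            ((poch ((m : ℂ) + a') j * poch ((m : ℂ) + b) j) /
              (poch 1 j * (Nat.factorial j : ℂ))) *
              (z * (1 - (t : ℂ)) * (1 - (u : ℂ))) ^ j) =
        z ^ m * (((t ^ (r - 1) : ℝ) : ℂ) * ∑' j : ℕ, d j * β j * (1 - (t : ℂ)) ^ j) := by
    have hct : Summable fun j => d j * (1 - (t : ℂ)) ^ j := by
      refine Summable.of_norm_bounded hdsum.norm fun j => ?_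
      rw [norm_mul, norm_pow, ← Complex.ofReal_one, ← Complex.ofReal_sub, Complex.norm_real]
      refine mul_le_of_le_one_right (norm_nonneg _) (pow_le_one₀ (norm_nonneg _) ?_)
      rw [Real.norm_eq_abs, abs_le]
      constructor <;> linarith [ht.1, ht.2]
    simp only [mul_right_comm (d _) (β _)]
    rw [(hasSum_integral_rpow_mul_tsum hqm hct).tsum_eq, ← mul_assoc,
      ← intervalIntegral.integral_const_mul]
    refine intervalIntegral.integral_congr_ae (.of_forall fun u hu => ?_)
    rw [Set.uIoc_of_le zero_le_one] at hu
    rw [← ofReal_rpow_mul_pow ht.1, ← ofReal_rpow_mul_pow hu.1]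
    simp only [hd, mul_pow, mul_assoc]
    ring
  have houter : Summable fun j => d j * β j := (hasSum_integral_rpow_mul_tsum hqm hdsum).summable
  rw [intervalIntegral.integral_congr_ae (.of_forall fun t ht => hinner t
    (by rwa [Set.uIoc_of_le zero_le_one] at ht)), intervalIntegral.integral_const_mul,
    ← (hasSum_integral_rpow_mul_tsum hpm houter).tsum_eq, ← tsum_mul_left, ← tsum_mul_left]
  refine tsum_congr fun j => ?_
  have hr1 : (r : ℂ) + 1 = p + m := by rw [hr]; push_cast; ring
  have hs1 : (s : ℂ) + 1 = q + m := by rw [hs]; push_cast; ring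
  have hP := poch_ofReal_ne_zero hp m
  have hQ := poch_ofReal_ne_zero hq m
  have hPj : poch ((p : ℂ) + m) j ≠ 0 := by
    exact_mod_cast poch_ofReal_ne_zero (by positivity : 0 < p + m) j
  have hQj : poch ((q : ℂ) + m) j ≠ 0 := by
    exact_mod_cast poch_ofReal_ne_zero (by positivity : 0 < q + m) j
  have hr0 : (r : ℂ) ≠ 0 := Complex.ofReal_ne_zero.mpr hpm.ne'
  have hs0 : (s : ℂ) ≠ 0 := Complex.ofReal_ne_zero.mpr hqm.ne'
  have hj : (j.factorial : ℂ) ≠ 0 := Nat.cast_ne_zero.mpr j.factorial_ne_zero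
  simp only [hd, hβ, hr1, hs1, poch_add, poch_one_left, pow_add, add_comm (m : ℂ)]
  field_simp
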